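/- Let K be an imaginary quadratic field and S a finite nonempty set of finite places. The squaring relation SQ = {(x,y) ∈ O_{K,S}² : y = x²} is positive-existentially definable in the structure (O_{K,S}; 0, 1, +, ∣). -/

import Mathlib

open FirstOrder IsDedekindDomain NumberField

/-- Function symbols of the divisibility language: constants `0`, `1` and binary `+`. -/
def DivFun : ℕ → Type
  | 0 => Fin 2
  | 2 => Unit
  | _ => Empty

/-- Relation symbols: a single binary relation `∣`. -/
def DivRel : ℕ → Type
  | 2 => Unit
  | _ => Empty

/-- The language `{=, 0, 1, +, ∣}`. -/
def DivLang : Language := ⟨DivFun, DivRel⟩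

/-- Any commutative ring is a structure for `DivLang`, interpreting `0`, `1`, `+` and
divisibility. -/
instance divStructure (R : Type*) [CommRing R] : DivLang.Structure R where
  funMap {n} f x :=
    match n, f, x with
    | 0, f, _ => if (show Fin 2 from f) = 0 then 0 else 1
    | 2, _, x => x 0 + x 1
  RelMap {n} r x :=
    match n, r, x with
    | 2, _, x => x 0 ∣ x 1

/-- Positive-existential bounded formulas: built from atomic formulas by `∧`, `∨` and `∃`. -/
inductive PosEx {α : Type} : {n : ℕ} → DivLang.BoundedFormula α n → Prop
  | equal {n} (t u : DivLang.Term (α ⊕ Fin n)) : PosEx (t.bdEqual u)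
  | rel {n l} (R : DivLang.Relations l) (ts : Fin l → DivLang.Term (α ⊕ Fin n)) :
      PosEx (FirstOrder.Language.BoundedFormula.rel R ts)
  | inf {n} {φ ψ : DivLang.BoundedFormula α n} : PosEx φ → PosEx ψ → PosEx (φ ⊓ ψ)
  | sup {n} {φ ψ : DivLang.BoundedFormula α n} : PosEx φ → PosEx ψ → PosEx (φ ⊔ ψ)
  | ex {n} {φ : DivLang.BoundedFormula α (n + 1)} : PosEx φ → PosEx φ.ex

section Heights

variable {A ι : Type*} [CommRing A] [Fintype ι]

/-- The product of the absolute values in a finite family. -/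
noncomputable def absProd (f : ι → AbsoluteValue A ℝ) (x : A) : ℝ := ∏ i, f i x

/-- The height attached to a finite family of absolute values. -/
noncomputable def absHeight (f : ι → AbsoluteValue A ℝ) (x : A) : ℝ := ∏ i, max 1 (f i x)

variable (f : ι → AbsoluteValue A ℝ)

lemma absProd_mul (x y : A) : absProd f (x * y) = absProd f x * absProd f y := by
  simp [absProd, Finset.prod_mul_distrib]

lemma absProd_nonneg (x : A) : 0 ≤ absProd f x :=
  Finset.prod_nonneg fun i _ => (f i).nonneg x

lemma one_le_absHeight (x : A) : 1 ≤ absHeight f x := by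
  unfold absHeight
  calc (1 : ℝ) = ∏ _i : ι, (1 : ℝ) := by simp
    _ ≤ _ := Finset.prod_le_prod (by simp) fun i _ => le_max_left _ _

lemma absProd_finsetProd [IsDomain A] {α : Type*} (s : Finset α) (g : α → A) :
    absProd f (∏ a ∈ s, g a) = ∏ a ∈ s, absProd f (g a) := by
  simp only [absProd, map_prod]
  exact Finset.prod_comm

lemma absProd_le_of_dvd [IsDomain A] (hf : ∀ x : A, x ≠ 0 → 1 ≤ absProd f x) {x y : A} (hy : y ≠ 0)
    (h : x ∣ y) : absProd f x ≤ absProd f y := by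
  obtain ⟨z, rfl⟩ := h
  rw [absProd_mul]
  exact le_mul_of_one_le_right (absProd_nonneg f x) (hf z (right_ne_zero_of_mul hy))

/-- A product of shifts of `y`, each dividing `e`, divides a fixed multiple of `e`. -/
lemma exists_prod_sub_dvd [IsDomain A] [CharZero A] (F : Finset ℕ) :
    ∃ D : A, D ≠ 0 ∧ ∀ y e : A, (∀ a ∈ F, y - (a : A) ∣ e) → ∏ a ∈ F, (y - (a : A)) ∣ D * e := by
  classical
  induction F using Finset.induction_on with
  | empty => exact ⟨1, one_ne_zero, by simp⟩
  | insert b F hb ih =>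
    obtain ⟨D, hD, h⟩ := ih
    refine ⟨(∏ a ∈ F, ((b : A) - (a : A))) * D, mul_ne_zero ?_ hD, fun y e he => ?_⟩
    · refine Finset.prod_ne_zero_iff.2 fun a ha => sub_ne_zero.2 ?_
      rintro hab
      exact hb (Nat.cast_injective hab ▸ ha)
    · rw [Finset.prod_insert hb]
      have hP := h y e fun a ha => he a (Finset.mem_insert_of_mem ha)
      have hbe := he b (Finset.mem_insert_self _ _)
      obtain ⟨q, hq⟩ : y - (b : A) ∣ ∏ a ∈ F, (y - (a : A)) - ∏ a ∈ F, ((b : A) - (a : A)) := by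
        have := Polynomial.sub_dvd_eval_sub y (b : A)
          (∏ a ∈ F, (Polynomial.X - Polynomial.C (a : A)))
        simpa [Polynomial.eval_prod] using this
      have hr : (∏ a ∈ F, ((b : A) - (a : A))) * D * e
          = D * (e * ∏ a ∈ F, (y - (a : A))) - q * ((y - b) * (D * e)) := by
        linear_combination (-D * e) * hq
      rw [hr]
      exact dvd_sub (Dvd.dvd.mul_left (mul_dvd_mul hbe dvd_rfl) _)
        (Dvd.dvd.mul_left (mul_dvd_mul dvd_rfl hP) _)

/-- All but at most `card ι` of the shifts of `y` have large norm. -/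
lemma exists_height_le_of_shifts [IsDomain A] [CharZero A] (F : Finset ℕ) :
    ∃ C : ℝ, 1 ≤ C ∧ ∀ y : A, ∃ G ⊆ F, F.card ≤ G.card + Fintype.card ι ∧
      ∀ a ∈ G, absHeight f y ≤ C * absProd f (y - (a : A)) := by
  classical
  obtain ⟨δ, hδ0, hδ1, hδ⟩ : ∃ δ : ℝ, 0 < δ ∧ δ ≤ 1 ∧
      ∀ i, ∀ a ∈ F, ∀ b ∈ F, a ≠ b → 2 * δ ≤ f i ((a : A) - b) := by
    let T : Finset ℝ := insert 1 ((Finset.univ ×ˢ F.offDiag).image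
      fun t : ι × ℕ × ℕ => f t.1 ((t.2.1 : A) - t.2.2) / 2)
    have hT : T.Nonempty := Finset.insert_nonempty _ _
    refine ⟨T.min' hT, ?_, Finset.min'_le _ _ (Finset.mem_insert_self _ _), ?_⟩
    · rw [Finset.lt_min'_iff]
      intro r hr
      simp only [T, Finset.mem_insert, Finset.mem_image, Finset.mem_product, Finset.mem_offDiag] at hr
      rcases hr with rfl | ⟨⟨i, a, b⟩, ⟨_, _, _, hab⟩, rfl⟩
      · exact one_pos
      · refine half_pos ((f i).pos (sub_ne_zero.2 fun h => hab (Nat.cast_injective h)))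
    · intro i a ha b hb hab
      have := Finset.min'_le T (f i ((a : A) - b) / 2) (by
        refine Finset.mem_insert_of_mem (Finset.mem_image.2 ⟨(i, a, b), ?_, rfl⟩)
        simp [ha, hb, hab])
      linarith
  obtain ⟨R, hR0, hR⟩ : ∃ R : ℝ, 0 ≤ R ∧ ∀ i, ∀ a ∈ F, f i (a : A) ≤ R := by
    refine ⟨∑ i, ∑ a ∈ F, f i (a : A), ?_, fun i a ha => ?_⟩
    · exact Finset.sum_nonneg fun i _ => Finset.sum_nonneg fun a _ => (f i).nonneg _
    · refine (Finset.single_le_sum (f := fun a : ℕ => f i (a : A))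
        (fun a _ => (f i).nonneg _) ha).trans ?_
      exact Finset.single_le_sum (f := fun i => ∑ a ∈ F, f i (a : A))
        (fun i _ => Finset.sum_nonneg fun a _ => (f i).nonneg _) (Finset.mem_univ i)
  have hc1 : 1 ≤ (1 + R) / δ := by
    rw [le_div_iff₀ hδ0]; linarith
  refine ⟨((1 + R) / δ) ^ Fintype.card ι, one_le_pow₀ hc1, fun y => ?_⟩
  refine ⟨F.filter fun a => ∀ i, δ ≤ f i (y - (a : A)), Finset.filter_subset _ _, ?_, ?_⟩
  · have hbad : (F.filter fun a : ℕ => ¬ ∀ i, δ ≤ f i (y - (a : A))).card ≤ Fintype.card ι := by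
      refine (Finset.card_le_card_of_forall_subsingleton (t := Finset.univ)
        (fun (a : ℕ) i => f i (y - (a : A)) < δ) (fun a ha => ?_) ?_).trans_eq Finset.card_univ
      · simpa using (Finset.mem_filter.1 ha).2
      · rintro i - a ⟨ha, h1⟩ b ⟨hb, h2⟩
        by_contra hne
        have h3 := hδ i a (Finset.mem_filter.1 ha).1 b (Finset.mem_filter.1 hb).1 hne
        have h4 : f i ((a : A) - b) ≤ f i (a - y) + f i (y - b) := (f i).sub_le _ _ _
        rw [(f i).map_sub (a : A) y] at h4
        linarith
    rw [← Finset.card_filter_add_card_filter_not (s := F)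
      (fun a => ∀ i, δ ≤ f i (y - (a : A)))]
    omega
  · intro a ha
    obtain ⟨haF, ha⟩ := Finset.mem_filter.1 ha
    rw [absHeight, absProd, ← Finset.card_univ, ← Finset.prod_const, ← Finset.prod_mul_distrib]
    refine Finset.prod_le_prod (fun i _ => by positivity) fun i _ => ?_
    have h1 := ha i
    have h2 := hR i a haF
    have h3 : f i y ≤ f i (y - a) + f i a := by simpa using (f i).add_le (y - a) a
    rw [div_mul_eq_mul_div, le_div_iff₀ hδ0]
    have h4 : R * δ ≤ R * f i (y - a) := mul_le_mul_of_nonneg_left h1 hR0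
    refine (mul_le_mul_of_nonneg_right (max_le ?_ ?_ : max 1 (f i y) ≤ (1 + R) * f i (y - a) / δ)
      hδ0.le).trans_eq (div_mul_cancel₀ _ hδ0.ne')
    · rw [le_div_iff₀ hδ0]; nlinarith
    · rw [le_div_iff₀ hδ0]
      nlinarith [(f i).nonneg (y - a)]

/-- If sufficiently many shifts of `y` divide `e ≠ 0`, the norm of `e` bounds a power of the height
of `y`. -/
lemma exists_absHeight_pow_le [IsDomain A] [CharZero A] (hf : ∀ x : A, x ≠ 0 → 1 ≤ absProd f x)
    (F : Finset ℕ) (B : ℕ) (hF : F.card = Fintype.card ι + B) :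
    ∃ C : ℝ, 1 ≤ C ∧ ∀ y e : A, e ≠ 0 → (∀ a ∈ F, y - (a : A) ∣ e) →
      absHeight f y ^ B ≤ C * absProd f e := by
  obtain ⟨D, hD, hdvd⟩ := exists_prod_sub_dvd (A := A) F
  obtain ⟨C, hC, hG⟩ := exists_height_le_of_shifts f F
  refine ⟨C ^ B * absProd f D, one_le_mul_of_one_le_of_one_le (one_le_pow₀ hC) (hf D hD),
    fun y e he hy => ?_⟩
  obtain ⟨G, hGF, hcard, hle⟩ := hG y
  obtain ⟨G', hG'G, hG'⟩ := Finset.exists_subset_card_eq (show B ≤ G.card by omega)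
  have hne : ∀ a ∈ F, y - (a : A) ≠ 0 := fun a ha h0 => he (zero_dvd_iff.1 (h0 ▸ hy a ha))
  have h1 : absProd f (∏ a ∈ F, (y - (a : A))) ≤ absProd f (D * e) :=
    absProd_le_of_dvd f hf (mul_ne_zero hD he) (hdvd y e hy)
  rw [absProd_finsetProd, absProd_mul] at h1
  have h2 : ∏ a ∈ G', absProd f (y - (a : A)) ≤ ∏ a ∈ F, absProd f (y - (a : A)) := by
    classical
    rw [← Finset.prod_sdiff (hG'G.trans hGF)]
    refine le_mul_of_one_le_left (Finset.prod_nonneg fun a _ => absProd_nonneg f _) ?_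
    calc (1 : ℝ) = ∏ _a ∈ F \ G', (1 : ℝ) := by simp
      _ ≤ _ := Finset.prod_le_prod (by simp)
        fun a ha => hf _ (hne a (Finset.mem_sdiff.1 ha).1)
  calc absHeight f y ^ B = ∏ _a ∈ G', absHeight f y := by rw [Finset.prod_const, hG']
    _ ≤ ∏ a ∈ G', (C * absProd f (y - (a : A))) :=
        Finset.prod_le_prod (fun _ _ => zero_le_one.trans (one_le_absHeight f y))
          fun a ha => hle a (hG'G ha)
    _ = C ^ B * ∏ a ∈ G', absProd f (y - (a : A)) := by
        rw [Finset.prod_mul_distrib, Finset.prod_const, hG']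
    _ ≤ C ^ B * (absProd f D * absProd f e) :=
        mul_le_mul_of_nonneg_left (h2.trans h1) (by positivity)
    _ = _ := by ring

/-- The norm of a difference of products is bounded by the heights. -/
lemma absProd_sub_le {x y a b c : A} (hx : ∀ i, f i x ≤ max 1 (f i a) * max 1 (f i b) * max 1 (f i c))
    (hy : ∀ i, f i y ≤ max 1 (f i a) * max 1 (f i b) * max 1 (f i c)) :
    absProd f (x - y) ≤
      2 ^ Fintype.card ι * (absHeight f a * absHeight f b * absHeight f c) := by
  simp only [absProd, absHeight]
  rw [← Finset.card_univ, ← Finset.prod_const, ← Finset.prod_mul_distrib,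
    ← Finset.prod_mul_distrib, ← Finset.prod_mul_distrib]
  refine Finset.prod_le_prod (fun i _ => (f i).nonneg _) fun i _ => ?_
  have : f i (x - y) ≤ f i x + f i y := by
    simpa [sub_eq_add_neg] using (f i).sub_le x 0 y
  linarith [hx i, hy i]

lemma absProd_sub_mul_self_le (x z : A) :
    absProd f (z - x * x) ≤
      2 ^ Fintype.card ι * (absHeight f x * absHeight f x * absHeight f z) := by
  have h1 : ∀ i y, 1 ≤ max 1 (f i y) := fun i y => le_max_left _ _
  have h2 : ∀ i y, f i y ≤ max 1 (f i y) := fun i y => le_max_right _ _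
  refine absProd_sub_le f (fun i => ?_) (fun i => ?_)
  · exact (h2 i z).trans (le_mul_of_one_le_left (zero_le_one.trans (h1 i z))
      (one_le_mul_of_one_le_of_one_le (h1 i x) (h1 i x)))
  · rw [map_mul]
    exact (mul_le_mul (h2 i x) (h2 i x) ((f i).nonneg _) (zero_le_one.trans (h1 i x))).trans
      (le_mul_of_one_le_right (by positivity) (h1 i z))

lemma absHeight_le_mul {x y : A} (hx : 1 ≤ absProd f x) :
    absHeight f y ≤ absHeight f (x * y) * absHeight f x := by
  refine (le_mul_of_one_le_left (zero_le_one.trans (one_le_absHeight f y)) hx).trans ?_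
  simp only [absProd, absHeight, ← Finset.prod_mul_distrib]
  refine Finset.prod_le_prod
    (fun i _ => mul_nonneg ((f i).nonneg _) (zero_le_one.trans (le_max_left _ _))) fun i _ => ?_
  rw [map_mul, mul_max_of_nonneg _ _ ((f i).nonneg x), mul_one]
  refine max_le ?_ ?_
  · exact (le_max_right _ _).trans
      (le_mul_of_one_le_left (zero_le_one.trans (le_max_left _ _)) (le_max_left _ _))
  · exact (le_max_right _ _).trans
      (le_mul_of_one_le_right (zero_le_one.trans (le_max_left _ _)) (le_max_left _ _))

end Heights

section Witness

variable {A : Type*} [CommRing A]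

/-- The system of divisibilities between integral linear forms, with auxiliary unknowns
`v₀, v₁, u, w, v`, whose solvability characterises `Z = X ^ 2`. In a solution `w = u⁻¹` and
`v = u ^ 2`, where `u ≠ 1` is a unit whose height is large compared with those of `X` and `Z`. -/
def SquareWitness (p q M N₀ : ℕ) (F : Finset ℕ) (X Z v₀ v₁ u w v : A) : Prop :=
  v₀ - 1 ∣ (N₀ : A) ∧ p * (v₀ - 1) ∣ v₁ - v₀ ∧ q * (v₁ - 1) ∣ u - v₁ ∧ (M : A) ∣ u - 1 ∧
    ∀ a ∈ F, X - (a : A) ∣ u - 1 ∧ Z - (a : A) ∣ u - 1 ∧ u - (a : A) ∣ 1 - a * w ∧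
      w - (a : A) ∣ 1 - a * u ∧ u - (a : A) ∣ v - (a ^ 2 : ℕ) ∧ v - (a : A) ∣ u - a * w ∧
      X - a * u ∣ Z - (a ^ 2 : ℕ) * v

lemma ne_one_of_mul_dvd [IsDomain A] {p x y : A} (hp : ¬ IsUnit p) (hx : x ≠ 1)
    (h : p * (x - 1) ∣ y - x) : y ≠ 1 := by
  rintro rfl
  obtain ⟨c, hc⟩ := h
  have hx' : x - 1 ≠ 0 := sub_ne_zero.2 hx
  refine hp (IsUnit.of_mul_eq_one (-c) (mul_right_cancel₀ hx' ?_))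
  linear_combination hc

lemma mul_sub_one_dvd_pow_sub {n t : ℕ} {x : A} (h : (n : A) ∣ x - 1) :
    (n : A) * (x - 1) ∣ x ^ (1 + n * t) - x := by
  have hn : (n : A) ∣ ∑ i ∈ Finset.range n, (x ^ t) ^ i := by
    have h1 : (n : A) ∣ ∑ i ∈ Finset.range n, ((x ^ t) ^ i - 1) :=
      Finset.dvd_sum fun i _ => h.trans (by
        rw [← pow_mul]; exact sub_one_dvd_pow_sub_one x (t * i))
    have h2 : ∑ i ∈ Finset.range n, (x ^ t) ^ i
        = ∑ i ∈ Finset.range n, ((x ^ t) ^ i - 1) + n := by simp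
    rw [h2]
    exact dvd_add h1 dvd_rfl
  have h3 : x ^ (1 + n * t) - x
      = x * ((∑ i ∈ Finset.range n, (x ^ t) ^ i) * (x ^ t - 1)) := by
    rw [geom_sum_mul]; ring
  rw [h3]
  exact Dvd.dvd.mul_left (mul_dvd_mul hn (sub_one_dvd_pow_sub_one x t)) x

lemma Nat.exists_mul_eq_coprime {p q : ℕ} (hpq : p.Coprime q) (d : ℕ) (hd : d ≠ 0) :
    ∃ d₁ d₂, d = d₁ * d₂ ∧ d₁.Coprime p ∧ d₂.Coprime q := by
  induction d using induction_on_primes with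
  | zero => exact absurd rfl hd
  | one => exact ⟨1, 1, by simp⟩
  | prime_mul r m hr ih =>
    obtain ⟨d₁, d₂, rfl, h₁, h₂⟩ := ih (right_ne_zero_of_mul hd)
    by_cases hrp : r ∣ p
    · have hrq : r.Coprime q := (hr.coprime_iff_not_dvd).2 fun h =>
        hr.one_lt.ne' (Nat.eq_one_of_dvd_coprimes hpq hrp h)
      exact ⟨d₁, r * d₂, by ring, h₁, hrq.mul_left h₂⟩
    · exact ⟨r * d₁, d₂, by ring, ((hr.coprime_iff_not_dvd).2 hrp).mul_left h₁, h₂⟩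

lemma Nat.exists_pow_eq_one_add_mul {d p : ℕ} (hp : 1 < p) (h : d.Coprime p) :
    ∃ k t, 0 < k ∧ d ^ k = 1 + p * t := by
  have h1 := Nat.ModEq.pow_totient h
  refine ⟨p.totient, d ^ p.totient / p, Nat.totient_pos.2 (by omega), ?_⟩
  have h2 := Nat.mod_add_div (d ^ p.totient) p
  rw [h1, Nat.mod_eq_of_lt hp] at h2
  exact h2.symm

lemma exists_squareWitness [IsDomain A] {p q M N₀ : ℕ} {F : Finset ℕ} (hp : 1 < p) (hq : 1 < q)
    (hpq : p.Coprime q) (hpu : ¬ IsUnit (p : A)) (hM : (M : A) ≠ 0) (hF : ∀ a ∈ F, p ∣ a)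
    (v₀ : Aˣ) (hv₀p : (p : A) ∣ v₀ - 1) (hv₀q : (q : A) ∣ v₀ - 1) (hN₀ : (v₀ : A) - 1 ∣ (N₀ : A))
    (hfin : ∀ m : A, m ≠ 0 → ∃ d : ℕ, d ≠ 0 ∧ m ∣ (v₀ : A) ^ d - 1)
    {X : A} (hX : (p : A) ∣ X + 1) :
    ∃ v₀ v₁ u w v : A, SquareWitness p q M N₀ F X (X ^ 2) v₀ v₁ u w v := by
  have hX0 : ∀ a ∈ F, X - (a : A) ≠ 0 := fun a ha h0 => by
    refine hpu (isUnit_of_dvd_one ?_)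
    have ha : (p : A) ∣ a := Nat.cast_dvd_cast (hF a ha)
    have := dvd_sub hX (ha.add (h0 ▸ dvd_zero (p : A)))
    simpa using this
  have hZ0 : ∀ a ∈ F, X ^ 2 - (a : A) ≠ 0 := fun a ha h0 => by
    refine hpu (isUnit_of_dvd_one ?_)
    have ha : (p : A) ∣ a := Nat.cast_dvd_cast (hF a ha)
    have h1 : (p : A) ∣ (X + 1) * (X - 1) := hX.mul_right _
    have h2 : (1 : A) = a - (X + 1) * (X - 1) := by linear_combination h0
    rw [h2]
    exact dvd_sub ha h1
  have hm : (M : A) * ((∏ a ∈ F, (X - (a : A))) * ∏ a ∈ F, (X ^ 2 - (a : A))) ≠ 0 :=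
    mul_ne_zero hM (mul_ne_zero (Finset.prod_ne_zero_iff.2 hX0) (Finset.prod_ne_zero_iff.2 hZ0))
  obtain ⟨d, hd, hdvd⟩ := hfin _ hm
  obtain ⟨d₁, d₂, rfl, h₁, h₂⟩ := Nat.exists_mul_eq_coprime hpq d hd
  obtain ⟨k₁, t₁, hk₁, e₁⟩ := Nat.exists_pow_eq_one_add_mul hp h₁
  obtain ⟨k₂, t₂, hk₂, e₂⟩ := Nat.exists_pow_eq_one_add_mul hq h₂
  have hu : ∀ c : A, c ∣ (v₀ : A) ^ (d₁ * d₂) - 1 →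
      c ∣ (((v₀ ^ (1 + p * t₁)) ^ (1 + q * t₂) : Aˣ) : A) - 1 := fun c hc => by
    obtain ⟨r, hr⟩ : d₁ * d₂ ∣ (1 + p * t₁) * (1 + q * t₂) := by
      rw [← e₁, ← e₂]
      exact mul_dvd_mul (dvd_pow_self _ hk₁.ne') (dvd_pow_self _ hk₂.ne')
    refine hc.trans ?_
    push_cast
    rw [← pow_mul, hr, pow_mul _ (d₁ * d₂) r]
    exact sub_one_dvd_pow_sub_one ((v₀ : A) ^ (d₁ * d₂)) r
  refine ⟨v₀, (v₀ ^ (1 + p * t₁) : Aˣ), ((v₀ ^ (1 + p * t₁)) ^ (1 + q * t₂) : Aˣ), ?_⟩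
  generalize hudef : (v₀ ^ (1 + p * t₁)) ^ (1 + q * t₂) = u at hu
  have hinv : (u : A) * ((u⁻¹ : Aˣ) : A) = 1 := u.mul_inv
  refine ⟨(u⁻¹ : Aˣ), (u : A) ^ 2, hN₀, ?_, ?_, hu _ ((dvd_mul_right _ _).trans hdvd),
    fun a ha => ⟨hu _ ?_, hu _ ?_, ?_, ?_, ?_, ?_, ?_⟩⟩
  · push_cast
    exact mul_sub_one_dvd_pow_sub hv₀p
  · rw [← hudef]
    push_cast
    exact mul_sub_one_dvd_pow_sub (hv₀q.trans (sub_one_dvd_pow_sub_one _ _))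
  · exact (((Finset.dvd_prod_of_mem _ ha).mul_right _).mul_left _).trans hdvd
  · exact (((Finset.dvd_prod_of_mem _ ha).mul_left _).mul_left _).trans hdvd
  · exact ⟨(u⁻¹ : Aˣ), by linear_combination -hinv⟩
  · exact ⟨u, by linear_combination -hinv⟩
  · exact ⟨u + a, by push_cast; ring⟩
  · exact ⟨((u⁻¹ : Aˣ) : A), by linear_combination (-(u : A)) * hinv⟩
  · exact ⟨X + a * u, by push_cast; ring⟩

lemma le_sq_of_pow_five_le {K g : ℝ} (hg : 1 ≤ g) (h : g ^ 5 ≤ K ^ 2 * g ^ 4) : g ≤ K ^ 2 := by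
  have h4 : 0 < g ^ 4 := by positivity
  refine le_of_mul_le_mul_right ?_ h4
  calc g * g ^ 4 = g ^ 5 := by ring
    _ ≤ _ := h

lemma height_chain_le {K s t x z : ℝ} (hK : 1 ≤ K) (ht : 1 ≤ t) (hx : 1 ≤ x)
    (hz : 1 ≤ z) (hxt : x ^ 5 ≤ K * t) (hzt : z ^ 5 ≤ K * t) (hts : t ≤ s * x)
    (hsx : s ^ 5 ≤ K * (x * x * z)) : t ≤ K ^ 13 := by
  have h1 : t ^ 4 ≤ K ^ 2 * x ^ 2 * z := by
    refine le_of_mul_le_mul_right ?_ (zero_lt_one.trans_le ht)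
    calc t ^ 4 * t = t ^ 5 := by ring
      _ ≤ (s * x) ^ 5 := by gcongr
      _ = s ^ 5 * x ^ 5 := by ring
      _ ≤ (K * (x * x * z)) * (K * t) := by gcongr
      _ = _ := by ring
  have h2 : t ^ 17 ≤ K ^ 13 := by
    refine le_of_mul_le_mul_right ?_ (show 0 < t ^ 3 by positivity)
    calc t ^ 17 * t ^ 3 = (t ^ 4) ^ 5 := by ring
      _ ≤ (K ^ 2 * x ^ 2 * z) ^ 5 := by gcongr
      _ = K ^ 10 * (x ^ 5) ^ 2 * z ^ 5 := by ring
      _ ≤ K ^ 10 * (K * t) ^ 2 * (K * t) := by gcongr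
      _ = K ^ 13 * t ^ 3 := by ring
  exact (le_self_pow₀ ht (by norm_num)).trans h2

lemma SquareWitness.eq_sq [IsDomain A] {ι : Type*} [Fintype ι] (f : ι → AbsoluteValue A ℝ)
    (hf : ∀ x : A, x ≠ 0 → 1 ≤ absProd f x) {p q M N₀ : ℕ} {F : Finset ℕ} {C : ℝ} (hC1 : 1 ≤ C)
    (hC : ∀ y e : A, e ≠ 0 → (∀ a ∈ F, y - (a : A) ∣ e) → absHeight f y ^ 5 ≤ C * absProd f e)
    (hM : 2 ^ Fintype.card ι * (C * 2 ^ Fintype.card ι) ^ 13 < absProd f (M : A))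
    (hp : ¬ IsUnit (p : A)) (hq : ¬ IsUnit (q : A)) (hN₀ : (N₀ : A) ≠ 0)
    {X Z v₀ v₁ u w v : A} (hX : X ≠ 0) (h : SquareWitness p q M N₀ F X Z v₀ v₁ u w v) :
    Z = X ^ 2 := by
  obtain ⟨h₀, h₁, h₂, hMu, h⟩ := h
  set n := Fintype.card ι
  set K := C * 2 ^ n with hKdef
  have h2n : (1 : ℝ) ≤ 2 ^ n := one_le_pow₀ (by norm_num)
  have hK : 1 ≤ K := one_le_mul_of_one_le_of_one_le hC1 h2n
  have hK2 : K ^ 2 ≤ K ^ 13 := pow_le_pow_right₀ hK (by norm_num)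
  have hH := one_le_absHeight f
  have hsub : ∀ x, absProd f (x - 1) ≤ 2 ^ n * absHeight f x := fun x => by
    refine (absProd_sub_le f (a := x) (b := 1) (c := 1) (fun i => ?_) (fun i => ?_)).trans_eq ?_
    · simp
    · simp
    · simp [absHeight, n]
  have hlarge : ∀ x : A, x ≠ 1 → (M : A) ∣ x - 1 → K ^ 13 < absHeight f x := fun x hx hMx => by
    have h3 := (hM.trans_le (absProd_le_of_dvd f hf (sub_ne_zero.2 hx) hMx)).trans_le (hsub x)
    exact lt_of_mul_lt_mul_left h3 (by positivity)
  have hu1 : u ≠ 1 := by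
    refine ne_one_of_mul_dvd hq (ne_one_of_mul_dvd hp ?_ h₁) h₂
    rintro rfl
    exact hN₀ (by simpa using h₀)
  have hu := hlarge u hu1 hMu
  -- `w` is the inverse of `u`
  have huw : u * w = 1 := by
    by_contra hne
    have he : 1 - u * w ≠ 0 := fun h0 => hne (by linear_combination -h0)
    have hN : C * absProd f (1 - u * w) ≤ K * (absHeight f u * absHeight f w) := by
      rw [hKdef, mul_assoc]
      refine mul_le_mul_of_nonneg_left ?_ (by positivity)
      refine (absProd_sub_le f (a := u) (b := w) (c := 1) (fun i => ?_) (fun i => ?_)).trans_eq ?_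
      · simp only [map_one, max_self, mul_one]
        exact one_le_mul_of_one_le_of_one_le (le_max_left _ _) (le_max_left _ _)
      · simp only [map_one, max_self, mul_one, map_mul]
        gcongr <;> exact le_max_right _ _
      · simp [absHeight, n]
    have e1 := (hC u _ he fun a ha => by
      have := dvd_sub (h a ha).2.2.1 (dvd_mul_right (u - a) w)
      exact this.trans (by ring_nf; rfl)).trans hN
    have e2 := (hC w _ he fun a ha => by
      have := dvd_sub (h a ha).2.2.2.1 (dvd_mul_right (w - a) u)
      exact this.trans (by ring_nf; rfl)).trans hN
    have hg := one_le_mul_of_one_le_of_one_le (hH u) (hH w)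
    have hle := le_sq_of_pow_five_le (K := K) hg (by
      calc (absHeight f u * absHeight f w) ^ 5 = absHeight f u ^ 5 * absHeight f w ^ 5 := by ring
        _ ≤ (K * (absHeight f u * absHeight f w)) * (K * (absHeight f u * absHeight f w)) := by
            have := hH u; have := hH w
            gcongr
        _ = K ^ 2 * (absHeight f u * absHeight f w) ^ 2 := by ring
        _ ≤ _ := by gcongr; norm_num)
    have := le_mul_of_one_le_right (zero_le_one.trans (hH u)) (hH w)
    linarith
  -- `v` is the square of `u`
  have hv : v = u ^ 2 := by
    by_contra hne
    have he : v - u * u ≠ 0 := fun h0 => hne (by linear_combination h0)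
    have hN : C * absProd f (v - u * u) ≤ K * (absHeight f u * absHeight f u * absHeight f v) := by
      rw [hKdef, mul_assoc]
      exact mul_le_mul_of_nonneg_left (absProd_sub_mul_self_le f u v) (by positivity)
    have e1 := (hC u _ he fun a ha => by
      have h3 := dvd_sub (h a ha).2.2.2.2.1 (dvd_mul_right (u - a) (u + a))
      have h4 : v - u * u = v - ((a ^ 2 : ℕ) : A) - (u - a) * (u + a) := by push_cast; ring
      rwa [h4]).trans hN
    have e2 := (hC v _ he fun a ha => by
      have h3 := (dvd_sub (dvd_mul_left (v - a) w) (h a ha).2.2.2.2.2.1).mul_left u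
      have h4 : v - u * u = u * (w * (v - a) - (u - a * w)) := by
        linear_combination (-v) * huw
      rwa [h4]).trans hN
    have hg := one_le_mul_of_one_le_of_one_le (hH u) (hH v)
    have hle := le_sq_of_pow_five_le (K := K) hg (by
      have hu' := hH u
      have hv' := hH v
      calc (absHeight f u * absHeight f v) ^ 5 = absHeight f u ^ 5 * absHeight f v ^ 5 := by ring
        _ ≤ (K * (absHeight f u * absHeight f u * absHeight f v)) *
            (K * (absHeight f u * absHeight f u * absHeight f v)) := by gcongr
        _ = K ^ 2 * (absHeight f u ^ 4 * absHeight f v ^ 2) := by ring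
        _ ≤ K ^ 2 * (absHeight f u ^ 4 * absHeight f v ^ 4) := by gcongr; norm_num
        _ = _ := by ring)
    have := le_mul_of_one_le_right (zero_le_one.trans (hH u)) (hH v)
    linarith
  by_contra hne
  have hw : w - 1 = -w * (u - 1) := by linear_combination huw
  have hw1 : w ≠ 1 := by
    rintro rfl
    exact hu1 (by linear_combination huw)
  have hwdvd : ∀ c, c ∣ u - 1 → c ∣ w - 1 := fun c hc => hw ▸ hc.mul_left _
  have hwlarge := hlarge w hw1 (hwdvd _ hMu)
  have hCw : C * absProd f (w - 1) ≤ K * absHeight f w := by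
    rw [hKdef, mul_assoc]
    exact mul_le_mul_of_nonneg_left (hsub w) (by positivity)
  have e1 := (hC X _ (sub_ne_zero.2 hw1) fun a ha => hwdvd _ (h a ha).1).trans hCw
  have e2 := (hC Z _ (sub_ne_zero.2 hw1) fun a ha => hwdvd _ (h a ha).2.1).trans hCw
  have e3 := hC (X * w) (Z - X * X) (fun h0 => hne (by linear_combination h0)) fun a ha => by
    have h3 := (h a ha).2.2.2.2.2.2
    have h4 : Z - X * X = Z - ((a ^ 2 : ℕ) : A) * v - (X - a * u) * (X + a * u) := by
      rw [hv]; push_cast; ring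
    have h5 : X - a * u = u * (X * w - a) := by linear_combination (-X) * huw
    have h6 : X * w - a ∣ X - a * u := h5 ▸ dvd_mul_left _ _
    rw [h4]
    exact h6.trans (dvd_sub h3 (dvd_mul_right _ _))
  have e4 : C * absProd f (Z - X * X) ≤ K * (absHeight f X * absHeight f X * absHeight f Z) := by
    rw [hKdef, mul_assoc]
    exact mul_le_mul_of_nonneg_left (absProd_sub_mul_self_le f X Z) (by positivity)
  have := height_chain_le hK (hH w) (hH X) (hH Z) e1 e2
    (absHeight_le_mul f (hf X hX)) (e3.trans e4)
  linarith

end Witness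

section Definability

open FirstOrder.Language

variable (A : Type*) [CommRing A]

/-- A relation between parameters `Fin 2 → A` and bound variables `Fin k → A` which is defined by a
positive-existential formula. -/
def PosExDef (k : ℕ) (s : (Fin 2 → A) → (Fin k → A) → Prop) : Prop :=
  ∃ φ : DivLang.BoundedFormula (Fin 2) k, PosEx φ ∧ ∀ v xs, φ.Realize v xs ↔ s v xs

/-- A function given by a term. -/
def TermFun (k : ℕ) (g : (Fin 2 → A) → (Fin k → A) → A) : Prop :=
  ∃ t : DivLang.Term (Fin 2 ⊕ Fin k), ∀ v xs, t.realize (Sum.elim v xs) = g v xs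

/-- A difference of two functions given by terms. -/
def LinFun (k : ℕ) (g : (Fin 2 → A) → (Fin k → A) → A) : Prop :=
  ∃ g₁ g₂, TermFun A k g₁ ∧ TermFun A k g₂ ∧ ∀ v xs, g v xs = g₁ v xs - g₂ v xs

variable {A} {k : ℕ}

lemma TermFun.var (i : Fin 2) : TermFun A k fun v _ => v i :=
  ⟨Term.var (Sum.inl i), fun _ _ => rfl⟩

lemma TermFun.bvar (i : Fin k) : TermFun A k fun _ xs => xs i :=
  ⟨Term.var (Sum.inr i), fun _ _ => rfl⟩

lemma TermFun.zero : TermFun A k fun _ _ => 0 :=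
  ⟨Term.func (L := DivLang) (l := 0) (show Fin 2 from 0) Fin.elim0, fun _ _ => rfl⟩

lemma TermFun.one : TermFun A k fun _ _ => 1 :=
  ⟨Term.func (L := DivLang) (l := 0) (show Fin 2 from 1) Fin.elim0, fun _ _ => rfl⟩

lemma TermFun.add {g h : (Fin 2 → A) → (Fin k → A) → A} (hg : TermFun A k g) (hh : TermFun A k h) :
    TermFun A k fun v xs => g v xs + h v xs := by
  obtain ⟨t, ht⟩ := hg
  obtain ⟨t', ht'⟩ := hh
  exact ⟨Term.func (L := DivLang) (l := 2) (show Unit from ()) ![t, t'], fun v xs =>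
    congrArg₂ (· + ·) (ht v xs) (ht' v xs)⟩

lemma TermFun.nsmul {g : (Fin 2 → A) → (Fin k → A) → A} (hg : TermFun A k g) (n : ℕ) :
    TermFun A k fun v xs => n * g v xs := by
  induction n with
  | zero => simpa using TermFun.zero
  | succ n ih => simpa [add_mul] using ih.add hg

lemma TermFun.lift {g : (Fin 2 → A) → (Fin k → A) → A} (hg : TermFun A k g) :
    TermFun A (k + 1) fun v xs => g v (Fin.init xs) := by
  obtain ⟨t, ht⟩ := hg
  refine ⟨t.relabel (Sum.map id Fin.castSucc), fun v xs => ?_⟩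
  rw [Term.realize_relabel]
  refine Eq.trans (congrArg t.realize ?_) (ht v (Fin.init xs))
  ext (i | i) <;> rfl

lemma TermFun.linFun {g : (Fin 2 → A) → (Fin k → A) → A} (hg : TermFun A k g) : LinFun A k g :=
  ⟨g, _, hg, TermFun.zero, by simp⟩

lemma LinFun.add {g h : (Fin 2 → A) → (Fin k → A) → A} (hg : LinFun A k g) (hh : LinFun A k h) :
    LinFun A k fun v xs => g v xs + h v xs := by
  obtain ⟨g₁, g₂, h₁, h₂, e⟩ := hg
  obtain ⟨g₁', g₂', h₁', h₂', e'⟩ := hh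
  exact ⟨_, _, h₁.add h₁', h₂.add h₂', fun v xs => by beta_reduce; rw [e, e']; ring⟩

lemma LinFun.sub {g h : (Fin 2 → A) → (Fin k → A) → A} (hg : LinFun A k g) (hh : LinFun A k h) :
    LinFun A k fun v xs => g v xs - h v xs := by
  obtain ⟨g₁, g₂, h₁, h₂, e⟩ := hg
  obtain ⟨g₁', g₂', h₁', h₂', e'⟩ := hh
  exact ⟨_, _, h₁.add h₂', h₂.add h₁', fun v xs => by beta_reduce; rw [e, e']; ring⟩

lemma LinFun.nsmul {g : (Fin 2 → A) → (Fin k → A) → A} (hg : LinFun A k g) (n : ℕ) :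
    LinFun A k fun v xs => n * g v xs := by
  obtain ⟨g₁, g₂, h₁, h₂, e⟩ := hg
  exact ⟨_, _, h₁.nsmul n, h₂.nsmul n, fun v xs => by beta_reduce; rw [e]; ring⟩

lemma LinFun.var (i : Fin 2) : LinFun A k fun v _ => v i := (TermFun.var i).linFun

lemma LinFun.bvar (i : Fin k) : LinFun A k fun _ xs => xs i := (TermFun.bvar i).linFun

lemma LinFun.one : LinFun A k fun _ _ => 1 := TermFun.one.linFun

lemma LinFun.natCast (n : ℕ) : LinFun A k fun _ _ => (n : A) := by
  simpa using (LinFun.one (A := A) (k := k)).nsmul n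

lemma PosExDef.and {s t : (Fin 2 → A) → (Fin k → A) → Prop} (hs : PosExDef A k s)
    (ht : PosExDef A k t) : PosExDef A k fun v xs => s v xs ∧ t v xs := by
  obtain ⟨φ, hφ, h⟩ := hs
  obtain ⟨ψ, hψ, h'⟩ := ht
  exact ⟨φ ⊓ ψ, .inf hφ hψ, fun v xs => by rw [BoundedFormula.realize_inf, h, h']⟩

lemma PosExDef.ex {s : (Fin 2 → A) → (Fin (k + 1) → A) → Prop} (hs : PosExDef A (k + 1) s) :
    PosExDef A k fun v xs => ∃ a, s v (Fin.snoc xs a) := by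
  obtain ⟨φ, hφ, h⟩ := hs
  exact ⟨φ.ex, .ex hφ, fun v xs => by simp only [BoundedFormula.realize_ex, h]⟩

lemma PosExDef.eq {g h : (Fin 2 → A) → (Fin k → A) → A} (hg : TermFun A k g) (hh : TermFun A k h) :
    PosExDef A k fun v xs => g v xs = h v xs := by
  obtain ⟨t, ht⟩ := hg
  obtain ⟨t', ht'⟩ := hh
  exact ⟨t.bdEqual t', .equal t t', fun v xs => by rw [BoundedFormula.realize_bdEqual, ht, ht']⟩

lemma PosExDef.termDvd {g h : (Fin 2 → A) → (Fin k → A) → A} (hg : TermFun A k g)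
    (hh : TermFun A k h) : PosExDef A k fun v xs => g v xs ∣ h v xs := by
  obtain ⟨t, ht⟩ := hg
  obtain ⟨t', ht'⟩ := hh
  refine ⟨BoundedFormula.rel (L := DivLang) (l := 2) (show Unit from ()) ![t, t'], .rel _ _,
    fun v xs => ?_⟩
  change t.realize (Sum.elim v xs) ∣ t'.realize (Sum.elim v xs) ↔ _
  rw [ht, ht']

lemma PosExDef.dvd {g h : (Fin 2 → A) → (Fin k → A) → A} (hg : LinFun A k g) (hh : LinFun A k h) :
    PosExDef A k fun v xs => g v xs ∣ h v xs := by
  obtain ⟨g₁, g₂, h₁, h₂, e⟩ := hg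
  obtain ⟨g₁', g₂', h₁', h₂', e'⟩ := hh
  have key : PosExDef A (k + 2) fun v xs =>
      (xs (Fin.last k).castSucc + g₂ v (Fin.init (Fin.init xs)) = g₁ v (Fin.init (Fin.init xs)) ∧
        xs (Fin.last (k + 1)) + g₂' v (Fin.init (Fin.init xs)) = g₁' v (Fin.init (Fin.init xs))) ∧
      xs (Fin.last k).castSucc ∣ xs (Fin.last (k + 1)) :=
    ((PosExDef.eq ((TermFun.bvar _).add h₂.lift.lift) h₁.lift.lift).and
      (PosExDef.eq ((TermFun.bvar _).add h₂'.lift.lift) h₁'.lift.lift)).and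
      (PosExDef.termDvd (TermFun.bvar _) (TermFun.bvar _))
  obtain ⟨φ, hφ, hr⟩ := key.ex.ex
  refine ⟨φ, hφ, fun v xs => (hr v xs).trans ?_⟩
  simp only [Fin.init_snoc, Fin.snoc_castSucc, Fin.snoc_last, e, e']
  constructor
  · rintro ⟨a, b, ⟨ha, hb⟩, hab⟩
    rwa [← ha, ← hb, add_sub_cancel_right, add_sub_cancel_right]
  · exact fun hab => ⟨_, _, ⟨sub_add_cancel _ _, sub_add_cancel _ _⟩, hab⟩

lemma PosExDef.forall_mem {α : Type*} (F : Finset α) {s : α → (Fin 2 → A) → (Fin k → A) → Prop}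
    (hs : ∀ a, PosExDef A k (s a)) : PosExDef A k fun v xs => ∀ a ∈ F, s a v xs := by
  classical
  induction F using Finset.induction_on with
  | empty => simpa using PosExDef.eq (A := A) (k := k) TermFun.zero TermFun.zero
  | insert b F _ ih => simpa [Finset.forall_mem_insert] using (hs b).and ih

lemma PosEx.exs {n : ℕ} {φ : DivLang.BoundedFormula (Fin 2) n} (h : PosEx φ) : PosEx φ.exs := by
  induction n with
  | zero => exact h
  | succ n ih => exact ih h.ex

lemma posExDef_squareWitness (p q M N₀ : ℕ) (F : Finset ℕ)
    {X Z : (Fin 2 → A) → (Fin 5 → A) → A} (hX : LinFun A 5 X) (hZ : LinFun A 5 Z) :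
    PosExDef A 5 fun v xs =>
      SquareWitness p q M N₀ F (X v xs) (Z v xs) (xs 0) (xs 1) (xs 2) (xs 3) (xs 4) := by
  have x (i : Fin 5) : LinFun A 5 fun _ xs => xs i := LinFun.bvar i
  have c (n : ℕ) : LinFun A 5 fun _ _ => (n : A) := LinFun.natCast n
  have o : LinFun A 5 fun _ _ => 1 := LinFun.one
  refine (PosExDef.dvd ((x 0).sub o) (c N₀)).and <|
    (PosExDef.dvd (((x 0).sub o).nsmul p) ((x 1).sub (x 0))).and <|
    (PosExDef.dvd (((x 1).sub o).nsmul q) ((x 2).sub (x 1))).and <|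
    (PosExDef.dvd (c M) ((x 2).sub o)).and <| PosExDef.forall_mem F fun a => ?_
  exact (PosExDef.dvd (hX.sub (c a)) ((x 2).sub o)).and <|
    (PosExDef.dvd (hZ.sub (c a)) ((x 2).sub o)).and <|
    (PosExDef.dvd ((x 2).sub (c a)) (o.sub ((x 3).nsmul a))).and <|
    (PosExDef.dvd ((x 3).sub (c a)) (o.sub ((x 2).nsmul a))).and <|
    (PosExDef.dvd ((x 2).sub (c a)) ((x 4).sub (c (a ^ 2)))).and <|
    (PosExDef.dvd ((x 4).sub (c a)) ((x 2).sub ((x 3).nsmul a))).and <|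
    PosExDef.dvd (hX.sub ((x 2).nsmul a)) (hZ.sub ((x 4).nsmul (a ^ 2)))

/-- A domain with enough units and a family of absolute values satisfying a weak product formula has
a positive-existentially definable squaring relation. -/
theorem exists_posEx_square [IsDomain A] [CharZero A] {ι : Type*} [Fintype ι]
    (f : ι → AbsoluteValue A ℝ) (hf : ∀ x : A, x ≠ 0 → 1 ≤ absProd f x)
    {P : ℕ} (hP : P ≠ 0) (hfP : ∀ n : ℕ, (1 + P * n : ℝ) ≤ absProd f ((1 + P * n : ℕ) : A))
    (hunit : ∀ m : ℕ, m ≠ 0 → ∃ (v₀ : Aˣ) (N₀ : ℕ), N₀ ≠ 0 ∧ (m : A) ∣ v₀ - 1 ∧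
      (v₀ : A) - 1 ∣ (N₀ : A) ∧ ∀ x : A, x ≠ 0 → ∃ d : ℕ, d ≠ 0 ∧ x ∣ (v₀ : A) ^ d - 1) :
    ∃ φ : DivLang.Formula (Fin 2), PosEx φ ∧
      ∀ v : Fin 2 → A, φ.Realize v ↔ v 1 = v 0 ^ 2 := by
  have hnu : ∀ n : ℕ, n ≠ 0 → ¬ IsUnit ((1 + P * n : ℕ) : A) := fun n hn hu => by
    have h1 := (hfP n).trans (absProd_le_of_dvd f hf one_ne_zero (isUnit_iff_dvd_one.1 hu))
    have h2 : absProd f (1 : A) = 1 := by simp [absProd]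
    have h3 : (0 : ℝ) < P * n := by positivity
    linarith
  set p := 1 + P * 1 with hp
  set q := 1 + P * p with hq
  have hp1 : 1 < p := by omega
  have hq1 : 1 < q := by
    have : 0 < P * p := by positivity
    omega
  have hpq : p.Coprime q := by simp [hq]
  let F : Finset ℕ := (Finset.range (Fintype.card ι + 5)).image (p * ·)
  have hF : ∀ a ∈ F, p ∣ a := by
    intro a ha
    obtain ⟨b, -, rfl⟩ := Finset.mem_image.1 ha
    exact dvd_mul_right p b
  have hFcard : F.card = Fintype.card ι + 5 := by
    rw [Finset.card_image_of_injective _ (mul_right_injective₀ (by omega)), Finset.card_range]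
  obtain ⟨C, hC1, hC⟩ := exists_absHeight_pow_le f hf F 5 hFcard
  obtain ⟨m, hm⟩ := exists_nat_gt (2 ^ Fintype.card ι * (C * 2 ^ Fintype.card ι) ^ 13 : ℝ)
  set M := 1 + P * m with hMdef
  have hM : 2 ^ Fintype.card ι * (C * 2 ^ Fintype.card ι) ^ 13 < absProd f (M : A) := by
    refine lt_of_lt_of_le hm (le_trans ?_ (hfP m))
    have h1 : (1 : ℝ) ≤ P := by exact_mod_cast Nat.one_le_iff_ne_zero.2 hP
    have h2 : (m : ℝ) ≤ P * m := le_mul_of_one_le_left (by positivity) h1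
    linarith
  obtain ⟨v₀, N₀, hN₀, hpq0, hv₀N, hfin⟩ := hunit (p * q) (mul_ne_zero (by omega) (by omega))
  rw [Nat.cast_mul] at hpq0
  have hpu : ¬ IsUnit (p : A) := hnu 1 one_ne_zero
  have hqu : ¬ IsUnit (q : A) := hnu p (by omega)
  have hXlin : LinFun A 5 fun v _ => p * v 0 - 1 := ((LinFun.var 0).nsmul p).sub LinFun.one
  have hZlin : LinFun A 5 fun v _ => ((p ^ 2 : ℕ) : A) * v 1 - (2 * p : ℕ) * v 0 + 1 :=
    (((LinFun.var 1).nsmul _).sub ((LinFun.var 0).nsmul _)).add LinFun.one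
  obtain ⟨φ, hφ, hr⟩ := posExDef_squareWitness p q M N₀ F hXlin hZlin
  refine ⟨φ.exs, hφ.exs, fun v => ?_⟩
  simp only [BoundedFormula.realize_exs, hr]
  have hp0 : (p : A) ≠ 0 := Nat.cast_ne_zero.2 (by omega)
  constructor
  · rintro ⟨xs, hxs⟩
    have hX0 : (p : A) * v 0 - 1 ≠ 0 := fun h0 =>
      hpu (IsUnit.of_mul_eq_one (v 0) (sub_eq_zero.1 h0))
    have := hxs.eq_sq f hf hC1 hC hM hpu hqu (Nat.cast_ne_zero.2 hN₀) hX0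
    refine mul_left_cancel₀ (pow_ne_zero 2 hp0) ?_
    push_cast at this
    linear_combination this
  · intro hv
    obtain ⟨w₀, v₁, u, w, y, h⟩ := exists_squareWitness (A := A) (M := M) hp1 hq1 hpq hpu
      (Nat.cast_ne_zero.2 (by omega)) hF v₀ ((dvd_mul_right _ _).trans hpq0)
      ((dvd_mul_left _ _).trans hpq0) hv₀N hfin (X := p * v 0 - 1) (by simp)
    refine ⟨![w₀, v₁, u, w, y], ?_⟩
    have hZ : ((p ^ 2 : ℕ) : A) * v 1 - (2 * p : ℕ) * v 0 + 1 = (p * v 0 - 1) ^ 2 := by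
      rw [hv]; push_cast; ring
    rw [hZ]
    exact h

end Definability

section SIntegers

open HeightOneSpectrum Set

variable {K : Type*} [Field K] [NumberField K]

lemma mem_asIdeal_iff_eq_of_span_eq_pow {v : HeightOneSpectrum (𝓞 K)} {ε : 𝓞 K} {n : ℕ}
    (hn : n ≠ 0) (h : Ideal.span {ε} = v.asIdeal ^ n) (w : HeightOneSpectrum (𝓞 K)) :
    ε ∈ w.asIdeal ↔ w = v := by
  rw [← Ideal.span_singleton_le_iff_mem, h]
  constructor
  · intro hle
    have hvw : v.asIdeal ≤ w.asIdeal := w.isPrime.le_of_pow_le hle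
    exact (HeightOneSpectrum.ext (v.isMaximal.eq_of_le w.isPrime.ne_top hvw)).symm
  · rintro rfl
    exact Ideal.pow_le_self hn

/-- Every place in `S` is the only zero of some integer which is an `S`-unit. -/
lemma exists_isUnit_algebraMap_integer {S : Set (HeightOneSpectrum (𝓞 K))}
    {v : HeightOneSpectrum (𝓞 K)} (hv : v ∈ S) :
    ∃ ε : 𝓞 K, ε ∈ v.asIdeal ∧ IsUnit (algebraMap (𝓞 K) (S.integer K) ε) := by
  let I : nonZeroDivisors (Ideal (𝓞 K)) := ⟨v.asIdeal, mem_nonZeroDivisors_of_ne_zero v.ne_bot⟩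
  have hI : ClassGroup.mk0 (I ^ Fintype.card (ClassGroup (𝓞 K))) = 1 := by
    rw [map_pow, pow_card_eq_one]
  rw [ClassGroup.mk0_eq_one_iff] at hI
  obtain ⟨ε, hε⟩ := hI
  have hspan : Ideal.span {ε} = v.asIdeal ^ Fintype.card (ClassGroup (𝓞 K)) := hε.symm
  have hmem := mem_asIdeal_iff_eq_of_span_eq_pow Fintype.card_ne_zero hspan
  have hε0 : (ε : K) ≠ 0 := by
    rw [RingOfIntegers.coe_ne_zero_iff]
    rintro rfl
    rw [Ideal.span_singleton_zero] at hspan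
    exact pow_ne_zero _ v.ne_bot hspan.symm
  refine ⟨ε, (hmem v).2 rfl, ?_⟩
  have hinv : (ε : K)⁻¹ ∈ S.integer K := by
    intro w hw
    have h1 : w.valuation K (ε : K) = 1 := by
      have h2 : ε ∉ w.asIdeal := fun h => hw ((hmem w).1 h ▸ hv)
      refine le_antisymm (w.valuation_le_one ε) (not_lt.1 fun h3 => h2 ?_)
      exact (w.valuation_lt_one_iff_mem ε).1 h3
    rw [map_inv₀, h1, inv_one]
  exact IsUnit.of_mul_eq_one ⟨(ε : K)⁻¹, hinv⟩ (Subtype.ext (mul_inv_cancel₀ hε0))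

/-- Modulo a nonzero `S`-integer, an integral `S`-unit has finite order. -/
lemma exists_dvd_pow_sub_one {S : Set (HeightOneSpectrum (𝓞 K))} {ε : 𝓞 K}
    (hε : IsUnit (algebraMap (𝓞 K) (S.integer K) ε)) {x : S.integer K} (hx : x ≠ 0) :
    ∃ d : ℕ, d ≠ 0 ∧ x ∣ algebraMap (𝓞 K) (S.integer K) (ε ^ d - 1) := by
  obtain ⟨a, b, hb, hab⟩ := IsFractionRing.div_surjective (𝓞 K) (x : K)
  have hb0 : algebraMap (𝓞 K) K b ≠ 0 :=
    RingOfIntegers.coe_ne_zero_iff.2 (nonZeroDivisors.ne_zero hb)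
  have hxa : x ∣ algebraMap (𝓞 K) (S.integer K) a :=
    ⟨algebraMap (𝓞 K) (S.integer K) b, Subtype.ext ((div_eq_iff hb0).1 hab)⟩
  have ha : a ≠ 0 := by
    rintro rfl
    apply hx
    ext
    simp [← hab]
  have : Finite (𝓞 K ⧸ Ideal.span {a}) :=
    Ideal.finiteQuotientOfFreeOfNeBot _ (by simpa using ha)
  obtain ⟨i, j, hij, h⟩ := Finite.exists_ne_map_eq_of_infinite
    fun n : ℕ => Ideal.Quotient.mk (Ideal.span {a}) (ε ^ n)
  wlog hlt : i < j generalizing i j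
  · exact this j i hij.symm h.symm (by omega)
  refine ⟨j - i, by omega, (hε.pow i).dvd_mul_left.1 (hxa.trans ?_)⟩
  rw [← map_pow, ← map_mul]
  refine map_dvd _ ?_
  rw [mul_sub, mul_one, ← pow_add, Nat.add_sub_cancel' hlt.le, ← Ideal.mem_span_singleton,
    ← Ideal.Quotient.eq]
  exact h.symm

/-- There are `S`-units congruent to `1` modulo a given integer, and of finite order modulo every
nonzero `S`-integer, whose difference from `1` divides a nonzero natural number. -/
lemma exists_unit_sub_one {S : Set (HeightOneSpectrum (𝓞 K))} (hS : S.Nonempty) {m : ℕ}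
    (hm : m ≠ 0) :
    ∃ (v₀ : (S.integer K)ˣ) (N₀ : ℕ), N₀ ≠ 0 ∧ (m : S.integer K) ∣ v₀ - 1 ∧
      (v₀ : S.integer K) - 1 ∣ (N₀ : S.integer K) ∧
      ∀ x : S.integer K, x ≠ 0 → ∃ d : ℕ, d ≠ 0 ∧ x ∣ (v₀ : S.integer K) ^ d - 1 := by
  obtain ⟨v, hv⟩ := hS
  obtain ⟨ε, hεv, hε⟩ := exists_isUnit_algebraMap_integer hv
  obtain ⟨d, hd, hmd⟩ := exists_dvd_pow_sub_one hε (x := (m : S.integer K))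
    (Nat.cast_ne_zero.2 hm)
  have hne : ε ^ d - 1 ≠ 0 := fun h0 => by
    have h1 : ε ^ d ∈ v.asIdeal := v.asIdeal.pow_mem_of_mem hεv d (Nat.pos_of_ne_zero hd)
    rw [sub_eq_zero.1 h0] at h1
    exact v.isPrime.ne_top ((Ideal.eq_top_iff_one _).2 h1)
  have hval : ((hε.unit ^ d : (S.integer K)ˣ) : S.integer K) =
      algebraMap (𝓞 K) (S.integer K) (ε ^ d) := by simp
  refine ⟨hε.unit ^ d, Ideal.absNorm (Ideal.span {ε ^ d - 1}), ?_, ?_, ?_, fun x hx => ?_⟩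
  · rwa [Ne, Ideal.absNorm_eq_zero_iff, Ideal.span_singleton_eq_bot]
  · rwa [hval, ← map_one (algebraMap (𝓞 K) (S.integer K)), ← map_sub]
  · rw [hval, ← map_one (algebraMap (𝓞 K) (S.integer K)), ← map_sub,
      ← map_natCast (algebraMap (𝓞 K) (S.integer K))]
    exact map_dvd _ (Ideal.mem_span_singleton.1 (Ideal.absNorm_mem _))
  · obtain ⟨e, he, hxe⟩ := exists_dvd_pow_sub_one hε hx
    refine ⟨e, he, hxe.trans ?_⟩
    rw [hval, map_sub, map_one, map_pow, map_pow, ← pow_mul, mul_comm, pow_mul]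
    exact sub_one_dvd_pow_sub_one _ d

/-- The absolute values on the `S`-integers attached to the places in `S` and the infinite places,
the latter repeated according to their multiplicities. -/
noncomputable def integerAbs (S : Set (HeightOneSpectrum (𝓞 K))) :
    S ⊕ (Σ w : InfinitePlace K, Fin w.mult) → AbsoluteValue (S.integer K) ℝ
  | .inl v => (FinitePlace.mk v.1).1.comp (f := algebraMap (S.integer K) K) Subtype.val_injective
  | .inr w => w.1.1.comp (f := algebraMap (S.integer K) K) Subtype.val_injective

lemma absProd_integerAbs (S : Set (HeightOneSpectrum (𝓞 K))) [Fintype S] (x : S.integer K) :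
    absProd (integerAbs S) x =
      (∏ v : S, FinitePlace.mk v.1 (x : K)) * ∏ w : InfinitePlace K, w (x : K) ^ w.mult := by
  rw [absProd, Fintype.prod_sum_type, Fintype.prod_sigma]
  congr 1
  refine Finset.prod_congr rfl fun w _ => ?_
  exact (Finset.prod_const (w (x : K))).trans (by simp)

lemma one_le_absProd_integerAbs (S : Set (HeightOneSpectrum (𝓞 K))) [Fintype S] {x : S.integer K}
    (hx : x ≠ 0) : 1 ≤ absProd (integerAbs S) x := by
  classical
  have hxK : (x : K) ≠ 0 := fun h => hx (Subtype.ext h)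
  rw [absProd_integerAbs, ← prod_abs_eq_one hxK, mul_comm]
  refine mul_le_mul_of_nonneg_right ?_
    (Finset.prod_nonneg fun w _ => pow_nonneg (apply_nonneg w _) _)
  rw [← finprod_comp_equiv FinitePlace.equivHeightOneSpectrum.symm]
  let g : HeightOneSpectrum (𝓞 K) → ℝ := fun v => FinitePlace.mk v (x : K)
  have hg : (Function.mulSupport g).Finite :=
    (FinitePlace.hasFiniteMulSupport hxK).preimage
      (FinitePlace.equivHeightOneSpectrum (K := K)).symm.injective.injOn
  change ∏ᶠ v, g v ≤ ∏ v : S, g v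
  rw [finprod_eq_prod_of_mulSupport_subset g (s := hg.toFinset ∪ S.toFinset)
      (by intro v hv; simp at hv; simp [hv]), Finset.prod_set_coe S (f := g)]
  refine Finset.prod_le_prod_of_subset_of_le_one Finset.subset_union_right
    (fun v _ => apply_nonneg (FinitePlace.mk v) _) fun v _ hv => ?_
  change FinitePlace.mk v (x : K) ≤ 1
  rw [FinitePlace.mk_apply, FinitePlace.norm_embedding']
  exact_mod_cast (WithZeroMulInt.toNNReal_le_one_iff (one_lt_absNorm_nnreal v)).2
    (integer_valuation_le_one S K x fun h => hv (mem_toFinset.2 h))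

lemma le_absProd_integerAbs_natCast (S : Set (HeightOneSpectrum (𝓞 K))) [Fintype S] {n : ℕ}
    (hn : n ≠ 0) (h : ∀ v ∈ S, (n : 𝓞 K) ∉ v.asIdeal) :
    (n : ℝ) ≤ absProd (integerAbs S) (n : S.integer K) := by
  rw [absProd_integerAbs]
  have h1 : ∀ v : S, FinitePlace.mk v.1 ((n : S.integer K) : K) = 1 := fun v => by
    have := (FinitePlace.norm_eq_one_iff_notMem K v.1 (n : 𝓞 K)).2 (h v v.2)
    rw [map_natCast] at this
    rw [FinitePlace.mk_apply, ← this]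
    simp
  have hn1 : (1 : ℝ) ≤ n := by exact_mod_cast Nat.one_le_iff_ne_zero.2 hn
  obtain ⟨w₀⟩ := (inferInstance : Nonempty (InfinitePlace K))
  rw [Finset.prod_congr rfl fun v _ => h1 v, Finset.prod_const_one, one_mul]
  have h2 : ∀ w : InfinitePlace K, (n : ℝ) ≤ w ((n : S.integer K) : K) ^ w.mult := fun w => by
    have : w ((n : S.integer K) : K) = n := by simp
    rw [this]
    exact le_self_pow₀ hn1 InfinitePlace.mult_ne_zero
  refine (h2 w₀).trans ?_
  rw [← Finset.prod_singleton (fun w : InfinitePlace K => w ((n : S.integer K) : K) ^ w.mult) w₀]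
  exact Finset.prod_le_prod_of_subset_of_one_le (Finset.subset_univ _)
    (fun w _ => pow_nonneg (apply_nonneg w _) _) fun w _ _ => hn1.trans (h2 w)

lemma exists_natCast_mem_asIdeal {S : Set (HeightOneSpectrum (𝓞 K))} (hS : S.Finite) :
    ∃ P : ℕ, P ≠ 0 ∧ ∀ v ∈ S, (P : 𝓞 K) ∈ v.asIdeal := by
  refine ⟨∏ v ∈ hS.toFinset, Ideal.absNorm v.asIdeal,
    Finset.prod_ne_zero_iff.2 fun v _ => Ideal.absNorm_eq_zero_iff.not.2 v.ne_bot, fun v hv => ?_⟩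
  exact Ideal.mem_of_dvd _ (Nat.cast_dvd_cast (Finset.dvd_prod_of_mem _ (hS.mem_toFinset.2 hv)))
    (Ideal.absNorm_mem v.asIdeal)

end SIntegers

/-- the squaring relation `{(x,y) : y = x²}` on `O_{K,S}` is
positive-existentially definable in the language `{=, 0, 1, +, ∣}`. -/
theorem square_posEx_definable {K : Type*} [Field K] [NumberField K]
    (hdeg : Module.finrank ℚ K = 2) (himg : IsEmpty (K →+* ℝ))
    (S : Set (HeightOneSpectrum (𝓞 K))) (hSfin : S.Finite) (hSne : S.Nonempty) :
    ∃ φ : DivLang.Formula (Fin 2), PosEx φ ∧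
      ∀ v : Fin 2 → S.integer K, φ.Realize v ↔ v 1 = v 0 ^ 2 := by
  have := hSfin.fintype
  obtain ⟨P, hP, hPS⟩ := exists_natCast_mem_asIdeal hSfin
  refine exists_posEx_square (integerAbs S) (fun x hx => one_le_absProd_integerAbs S hx) hP
    (fun n => ?_) fun m hm => exists_unit_sub_one hSne hm
  refine le_trans (by push_cast; rfl) (le_absProd_integerAbs_natCast S (n := 1 + P * n)
    (by omega) fun v hv h1 => v.isPrime.ne_top ((Ideal.eq_top_iff_one _).2 ?_))
  rw [Nat.cast_add, Nat.cast_one, Nat.cast_mul] at h1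
  exact (Ideal.add_mem_iff_left _ (Ideal.mul_mem_right _ _ (hPS v hv))).1 h1
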